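/- There exist no differentiable functions α, β, γ, μ, ν : [0,∞) → ℝ forming an admissible solution of System B on all of [0,∞). (Equivalently: every homogeneous Ricci flow on SL(2,ℂ)/U(1), written in these coordinates, has a finite-time extinction.) -/

import Mathlib

/-- **System B**: the homogeneous Ricci flow equations on `SL(2,ℂ)/U(1)` for
real-valued differentiable functions `α β γ μ ν` on a set `s`, with `τ := μ² + ν²`,
together with the admissibility conditions `α > 0`, `β > 0`, `γ > 0`, `βγ > τ`. -/
def IsAdmissibleSolutionB (α β γ μ ν : ℝ → ℝ) (s : Set ℝ) : Prop :=
  ∀ t ∈ s,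
    0 < α t ∧ 0 < β t ∧ 0 < γ t ∧
    μ t ^ 2 + ν t ^ 2 < β t * γ t ∧
    HasDerivWithinAt α
      (2 * (16 * β t * γ t - α t ^ 2) / (β t * γ t - (μ t ^ 2 + ν t ^ 2))) s t ∧
    HasDerivWithinAt β
      (-(β t * (16 * (μ t ^ 2 + ν t ^ 2) - α t ^ 2)) /
        (α t * (β t * γ t - (μ t ^ 2 + ν t ^ 2)))) s t ∧
    HasDerivWithinAt γ
      (-(γ t * (16 * (μ t ^ 2 + ν t ^ 2) - α t ^ 2)) /
        (α t * (β t * γ t - (μ t ^ 2 + ν t ^ 2)))) s t ∧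
    HasDerivWithinAt μ
      (8 - μ t * (16 * β t * γ t - α t ^ 2) /
        (α t * (β t * γ t - (μ t ^ 2 + ν t ^ 2)))) s t ∧
    HasDerivWithinAt ν
      (-(ν t * (16 * β t * γ t - α t ^ 2)) /
        (α t * (β t * γ t - (μ t ^ 2 + ν t ^ 2)))) s t

/-- Linear lower bound from a lower bound on the derivative. -/
lemma growthB (f f' : ℝ → ℝ) (a c : ℝ) (ha : 0 ≤ a)
    (hf : ∀ t ∈ Set.Ici (0:ℝ), HasDerivWithinAt f (f' t) (Set.Ici 0) t)
    (hc : ∀ t, a ≤ t → c ≤ f' t) : ∀ t, a ≤ t → f a + c * (t - a) ≤ f t := by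
  intro t hat
  have hmono : MonotoneOn (fun x => f x - c * x) (Set.Ici a) := by
    apply monotoneOn_of_hasDerivWithinAt_nonneg (convex_Ici a) (f' := fun x => f' x - c)
    · intro x hx
      have hx' : a ≤ x := hx
      have h1 := (hf x (ha.trans hx')).continuousWithinAt.mono (Set.Ici_subset_Ici.2 ha)
      exact h1.sub (by fun_prop)
    · intro x hx
      rw [interior_Ici] at hx ⊢
      have hx' : a < x := hx
      have h1 := (hf x (ha.trans hx'.le)).mono
        (Set.Ioi_subset_Ici_self.trans (Set.Ici_subset_Ici.2 ha) : Set.Ioi a ⊆ Set.Ici 0)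
      have h2 : HasDerivWithinAt (fun x : ℝ => c * x) c (Set.Ioi a) x := by
        simpa using ((hasDerivAt_id x).const_mul c).hasDerivWithinAt
      exact h1.sub h2
    · intro x hx
      rw [interior_Ici] at hx
      have hx' : a < x := hx
      have := hc x hx'.le
      linarith
  have := hmono (Set.mem_Ici.2 le_rfl) (Set.mem_Ici.2 hat) hat
  simp only at this
  linarith

/-- Barrier lemma. -/
lemma barrierB (f f' : ℝ → ℝ) (a c : ℝ) (ha : 0 ≤ a)
    (hf : ∀ t ∈ Set.Ici (0:ℝ), HasDerivWithinAt f (f' t) (Set.Ici 0) t)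
    (h0 : c ≤ f a)
    (hc : ∀ t, a ≤ t → f t = c → 0 < f' t) : ∀ t, a ≤ t → c ≤ f t := by
  intro t hat
  have key := image_le_of_deriv_right_lt_deriv_boundary' (f := fun x => - f x)
    (f' := fun x => - f' x) (a := a) (b := t) (B := fun _ => -c) (B' := fun _ => 0)
    (by
      intro x hx
      exact ((hf x (ha.trans hx.1)).continuousWithinAt.mono
        (fun y hy => ha.trans hy.1)).neg)
    (by
      intro x hx
      exact ((hf x (ha.trans hx.1)).mono (Set.Ici_subset_Ici.2 (ha.trans hx.1))).neg)
    (by simpa using h0) (by fun_prop)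
    (fun x _ => hasDerivWithinAt_const _ _ _)
    (by
      intro x hx hxe
      have := hc x hx.1 (by simpa using hxe)
      simpa using this)
  have := key (x := t) ⟨hat, le_rfl⟩
  simpa using this

theorem no_admissible_solution_systemB_on_Ici :
    ¬ ∃ α β γ μ ν : ℝ → ℝ, IsAdmissibleSolutionB α β γ μ ν (Set.Ici 0) := by
  rintro ⟨α, β, γ, μ, ν, H⟩
  have hα : ∀ t, 0 ≤ t → 0 < α t := fun t ht => (H t ht).1
  have hP : ∀ t, 0 ≤ t → 0 < β t * γ t := fun t ht => mul_pos (H t ht).2.1 (H t ht).2.2.1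
  have hD : ∀ t, 0 ≤ t → 0 < β t * γ t - (μ t ^ 2 + ν t ^ 2) :=
    fun t ht => sub_pos.2 (H t ht).2.2.2.1
  -- Q = α β γ
  have hQ' : ∀ t ∈ Set.Ici (0:ℝ), HasDerivWithinAt (fun t => α t * (β t * γ t))
      (32 * (β t * γ t)) (Set.Ici 0) t := by
    intro t ht
    obtain ⟨h1, -, -, -, dα, dβ, dγ, -, -⟩ := H t ht
    have hd := (hD t ht).ne'
    refine HasDerivWithinAt.congr_deriv (dα.mul (dβ.mul dγ)) ?_
    try simp only [Pi.mul_apply]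
    have := h1.ne'
    generalize hDD : β t * γ t - (μ t ^ 2 + ν t ^ 2) = D at *
    have hτ : μ t ^ 2 + ν t ^ 2 = β t * γ t - D := by linarith
    rw [hτ]
    field_simp
    ring
  have hQ : ∀ t, 0 ≤ t → α 0 * (β 0 * γ 0) ≤ α t * (β t * γ t) := by
    intro t ht
    have := growthB _ _ 0 0 le_rfl hQ' (fun t ht => by have := hP t ht; positivity) t ht
    simpa using this
  have hQ0 : 0 < α 0 * (β 0 * γ 0) := mul_pos (hα 0 le_rfl) (hP 0 le_rfl)
  -- lower bound on α
  obtain ⟨δ, hδ, hδα⟩ : ∃ δ > 0, ∀ t, 0 ≤ t → δ ≤ α t := by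
    refine ⟨min (α 0) (min 1 (α 0 * (β 0 * γ 0))),
      lt_min (hα 0 le_rfl) (lt_min one_pos hQ0), ?_⟩
    apply barrierB α _ 0 _ le_rfl (fun t ht => (H t ht).2.2.2.2.1) (min_le_left _ _)
    intro t ht he
    have h1 : α t ≤ 1 := by rw [he]; exact (min_le_right _ _).trans (min_le_left _ _)
    have h2 : α t ≤ α 0 * (β 0 * γ 0) := by
      rw [he]; exact (min_le_right _ _).trans (min_le_right _ _)
    have h3 := hQ t ht
    have h4 := hα t ht
    have h5 : 1 ≤ β t * γ t := by
      have : α t * 1 ≤ α t * (β t * γ t) := by linarith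
      exact le_of_mul_le_mul_left this h4
    apply div_pos _ (hD t ht)
    nlinarith
  -- m and n
  have hs : ∀ t ∈ Set.Ici (0:ℝ), HasDerivWithinAt (fun t => Real.sqrt (α t))
      ((2 * (16 * β t * γ t - α t ^ 2) / (β t * γ t - (μ t ^ 2 + ν t ^ 2))) /
        (2 * Real.sqrt (α t))) (Set.Ici 0) t := fun t ht =>
    (H t ht).2.2.2.2.1.sqrt (hα t ht).ne'
  have hm' : ∀ t ∈ Set.Ici (0:ℝ), HasDerivWithinAt (fun t => μ t * Real.sqrt (α t))
      (8 * Real.sqrt (α t)) (Set.Ici 0) t := by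
    intro t ht
    have dμ := (H t ht).2.2.2.2.2.2.2.1
    refine HasDerivWithinAt.congr_deriv (dμ.mul (hs t ht)) ?_
    have hd := (hD t ht).ne'
    have hsp := (Real.sqrt_pos.2 (hα t ht)).ne'
    have hsq := Real.sq_sqrt (hα t ht).le
    have := (hα t ht).ne'
    generalize β t * γ t - (μ t ^ 2 + ν t ^ 2) = D at *
    generalize Real.sqrt (α t) = s at *
    rw [← hsq]
    field_simp
    ring
  have hn' : ∀ t ∈ Set.Ici (0:ℝ), HasDerivWithinAt (fun t => ν t * Real.sqrt (α t))
      0 (Set.Ici 0) t := by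
    intro t ht
    have dν := (H t ht).2.2.2.2.2.2.2.2
    refine HasDerivWithinAt.congr_deriv (dν.mul (hs t ht)) ?_
    have hd := (hD t ht).ne'
    have hsp := (Real.sqrt_pos.2 (hα t ht)).ne'
    have hsq := Real.sq_sqrt (hα t ht).le
    have := (hα t ht).ne'
    generalize β t * γ t - (μ t ^ 2 + ν t ^ 2) = D at *
    generalize Real.sqrt (α t) = s at *
    rw [← hsq]
    field_simp
    ring
  have hn : ∀ t, 0 ≤ t → ν t * Real.sqrt (α t) = ν 0 * Real.sqrt (α 0) := by
    intro t ht
    have h1 := growthB _ _ 0 0 le_rfl hn' (fun t ht => le_rfl) t ht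
    have h2 := growthB _ _ 0 0 le_rfl (fun t ht => (hn' t ht).neg) (fun t ht => by simp) t ht
    simp at h1 h2
    linarith
  have hsδ : 0 < Real.sqrt δ := Real.sqrt_pos.2 hδ
  have hm : ∀ t, 0 ≤ t →
      μ 0 * Real.sqrt (α 0) + 8 * Real.sqrt δ * (t - 0) ≤ μ t * Real.sqrt (α t) := by
    apply growthB _ _ 0 _ le_rfl hm'
    intro t ht
    have := Real.sqrt_le_sqrt (hδα t ht)
    linarith
  obtain ⟨T, hT, hTμ⟩ : ∃ T, 0 ≤ T ∧ ∀ t, T ≤ t → 0 < μ t ∧ ν t ^ 2 ≤ μ t ^ 2 := by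
    set K := |μ 0 * Real.sqrt (α 0)| + |ν 0 * Real.sqrt (α 0)| + 1 with hK
    have hKp : 0 < K := by positivity
    refine ⟨K / (8 * Real.sqrt δ), by positivity, ?_⟩
    intro t ht
    have ht0 : 0 ≤ t := le_trans (by positivity) ht
    rw [div_le_iff₀ (by positivity)] at ht
    have h1 := hm t ht0
    have h2 := neg_abs_le (μ 0 * Real.sqrt (α 0))
    have h3 : |ν 0 * Real.sqrt (α 0)| + 1 ≤ μ t * Real.sqrt (α t) := by linarith
    rw [← hn t ht0] at h3
    have hsp := Real.sqrt_pos.2 (hα t ht0)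
    rw [abs_mul, abs_of_pos hsp] at h3
    have h4 : |ν t| < μ t := by
      have : |ν t| * Real.sqrt (α t) < μ t * Real.sqrt (α t) := by linarith
      exact lt_of_mul_lt_mul_right this hsp.le
    exact ⟨lt_of_le_of_lt (abs_nonneg _) h4, sq_le_sq.2 (h4.le.trans (le_abs_self _))⟩
  -- u = 8 μ - α
  have hu' : ∀ t ∈ Set.Ici (0:ℝ), HasDerivWithinAt (fun t => 8 * μ t - α t)
      (64 - (2 * (16 * β t * γ t - α t ^ 2) / (β t * γ t - (μ t ^ 2 + ν t ^ 2))) *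
        (1 + 4 * μ t / α t)) (Set.Ici 0) t := by
    intro t ht
    obtain ⟨h1, -, -, -, dα, -, -, dμ, -⟩ := H t ht
    refine HasDerivWithinAt.congr_deriv ((dμ.const_mul 8).sub dα) ?_
    have hd := (hD t ht).ne'
    have := h1.ne'
    generalize β t * γ t - (μ t ^ 2 + ν t ^ 2) = D at *
    field_simp
    ring
  have hub : ∀ t, T ≤ t → 8 * μ t - α t ≤ δ / 4 →
      12 ≤ 64 - (2 * (16 * β t * γ t - α t ^ 2) / (β t * γ t - (μ t ^ 2 + ν t ^ 2))) *
        (1 + 4 * μ t / α t) := by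
    intro t ht hu
    have ht0 := hT.trans ht
    obtain ⟨hμ, hν⟩ := hTμ t ht
    have hd := hD t ht0
    have ha := hα t ht0
    have hda := hδα t ht0
    have h8 : 8 * μ t ≤ 5 / 4 * α t := by linarith
    have h1 : 2 * (16 * β t * γ t - α t ^ 2) / (β t * γ t - (μ t ^ 2 + ν t ^ 2)) ≤ 32 := by
      rw [div_le_iff₀ hd]
      nlinarith
    have h2 : 4 * μ t / α t ≤ 5 / 8 := by
      rw [div_le_iff₀ ha]; linarith
    have h3 : 0 < 4 * μ t / α t := by positivity
    generalize 2 * (16 * β t * γ t - α t ^ 2) / (β t * γ t - (μ t ^ 2 + ν t ^ 2)) = A at *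
    nlinarith
  obtain ⟨T1, hT1, hT1u⟩ : ∃ T1, T ≤ T1 ∧ δ / 4 ≤ 8 * μ T1 - α T1 := by
    by_contra hcon
    push Not at hcon
    have h1 := growthB _ _ T 12 hT hu' (fun t ht => hub t ht (hcon t ht).le)
    set K := |8 * μ T - α T| + δ with hK
    have hKp : 0 < K := by positivity
    have h2 := h1 (T + K) (by linarith)
    have h3 := hcon (T + K) (by linarith)
    have h4 := neg_abs_le (8 * μ T - α T)
    have h5 := abs_nonneg (8 * μ T - α T)
    linarith
  have hT10 := hT.trans hT1
  have hu : ∀ t, T1 ≤ t → δ / 4 ≤ 8 * μ t - α t := by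
    apply barrierB _ _ T1 _ hT10 hu' hT1u
    intro t ht he
    have := hub t (hT1.trans ht) he.le
    linarith
  -- D
  have hD' : ∀ t ∈ Set.Ici (0:ℝ),
      HasDerivWithinAt (fun t => -(β t * γ t - (μ t ^ 2 + ν t ^ 2)))
      (2 * (8 * μ t - α t)) (Set.Ici 0) t := by
    intro t ht
    obtain ⟨h1, -, -, -, -, dβ, dγ, dμ, dν⟩ := H t ht
    have hd := (hD t ht).ne'
    refine HasDerivWithinAt.congr_deriv (((dβ.mul dγ).sub ((dμ.pow 2).add (dν.pow 2))).neg) ?_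
    have := h1.ne'
    generalize hDD : β t * γ t - (μ t ^ 2 + ν t ^ 2) = D at *
    field_simp
    push_cast
    subst hDD
    ring
  have hfin := growthB _ _ T1 (δ / 2) hT10 hD' (fun t ht => by have := hu t ht; linarith)
  have hDT := hD T1 hT10
  set D1 := β T1 * γ T1 - (μ T1 ^ 2 + ν T1 ^ 2) with hD1
  have hx : 0 ≤ D1 / (δ / 2) := by positivity
  have h1 := hfin (T1 + D1 / (δ / 2)) (by linarith)
  have h2 := hD (T1 + D1 / (δ / 2)) (by linarith)
  have h3 : δ / 2 * (T1 + D1 / (δ / 2) - T1) = D1 := by field_simp; ring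
  rw [h3] at h1
  linarith
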